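/- If x ∈ E₁ and x(2) ≤ x(3) ≤ x(4), then x belongs to the convex hull of {v₁, v₂, v₃, v₄}. Moreover, E₁ = ⋃_{k=1}^{6} co({v_i : i ∈ A_k}), where A₁ = {1,2,3,4}, A₂ = {1,3,4,5}, A₃ = {1,4,6,7}, A₄ = {1,2,4,8}, A₅ = {1,4,5,6}, A₆ = {1,4,7,8}. -/

import Mathlib

/-- The face `E₁ = {x ∈ ℓ∞⁴ : x(1) = 1 = ‖x‖}` of the unit ball of `ℓ∞⁴`
(here `Fin 4 → ℝ` carries the sup norm, i.e. it is `ℓ∞⁴`). -/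
def E1 : Set (Fin 4 → ℝ) := {x | x 0 = 1 ∧ ‖x‖ = 1}

/-- The eight vertices `v₁, …, v₈` of `E₁` (0-indexed). -/
def v : Fin 8 → (Fin 4 → ℝ) :=
  ![![1, 1, 1, 1], ![1, -1, 1, 1], ![1, -1, -1, 1], ![1, -1, -1, -1],
    ![1, 1, -1, 1], ![1, 1, -1, -1], ![1, 1, 1, -1], ![1, -1, 1, -1]]

/-- A convex combination of four points lies in the convex hull of any set containing them. -/
theorem mem_convexHull_of_four {E : Type*} [AddCommGroup E] [Module ℝ E] {S : Set E}
    {p q r s x : E} (hp : p ∈ S) (hq : q ∈ S) (hr : r ∈ S) (hs : s ∈ S) (a b c d : ℝ)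
    (ha : 0 ≤ a) (hb : 0 ≤ b) (hc : 0 ≤ c) (hd : 0 ≤ d) (h : a + b + c + d = 1)
    (hx : a • p + b • q + c • r + d • s = x) : x ∈ convexHull ℝ S := by
  have key := (convex_convexHull ℝ S).sum_mem (t := Finset.univ) (w := ![a, b, c, d])
    (z := ![p, q, r, s])
    (by intro i _; fin_cases i <;> assumption)
    (by simpa [Fin.sum_univ_four] using h)
    (by intro i _; fin_cases i <;> exact subset_convexHull ℝ S (by assumption))
  simpa [Fin.sum_univ_four, hx] using key

theorem mem_E1_iff {x : Fin 4 → ℝ} :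
    x ∈ E1 ↔ x 0 = 1 ∧ ∀ i, -1 ≤ x i ∧ x i ≤ 1 := by
  simp only [E1, Set.mem_ofPred_eq, ← abs_le, ← Real.norm_eq_abs]
  refine and_congr_right fun h0 => ⟨fun h i => h ▸ norm_le_pi_norm x i, fun h => ?_⟩
  refine le_antisymm ((pi_norm_le_iff_of_nonneg zero_le_one).2 h) ?_
  simpa [h0] using norm_le_pi_norm x 0

theorem convex_E1 : Convex ℝ E1 := by
  intro x hx y hy a b ha hb hab
  rw [mem_E1_iff] at *
  refine ⟨by simp [hx.1, hy.1, hab], fun i => ?_⟩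
  simp only [Pi.add_apply, Pi.smul_apply, smul_eq_mul]
  obtain ⟨hx1, hx2⟩ := hx.2 i
  obtain ⟨hy1, hy2⟩ := hy.2 i
  constructor <;> nlinarith

theorem v_mem_E1 (k : Fin 8) : v k ∈ E1 := by
  rw [mem_E1_iff]
  refine ⟨by fin_cases k <;> rfl, fun i => ?_⟩
  fin_cases k <;> fin_cases i <;> norm_num [v]

/-- The simplex spanned by four of the vertices is contained in the face `E₁`. -/
theorem convexHull_v_subset_E1 (i j k l : Fin 8) :
    convexHull ℝ {v i, v j, v k, v l} ⊆ E1 := by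
  refine convexHull_min ?_ convex_E1
  rintro _ (rfl | rfl | rfl | rfl) <;> exact v_mem_E1 _

/-- Membership in the simplex of a monotone vertex path from `v₁` to `v₄`, the coordinates being
lowered in the order `a`, `b`, `c`. -/
theorem mem_convexHull_of_sorted {x : Fin 4 → ℝ} (hx : x ∈ E1) {S : Set (Fin 4 → ℝ)}
    (a b c : Fin 4) {p q : Fin 4 → ℝ} (hS₁ : v 0 ∈ S) (hp : p ∈ S) (hq : q ∈ S) (hS₄ : v 3 ∈ S)
    (hab : x a ≤ x b) (hbc : x b ≤ x c)
    (h : ((1 + x a) / 2) • v 0 + ((x b - x a) / 2) • p + ((x c - x b) / 2) • q +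
      ((1 - x c) / 2) • v 3 = x) : x ∈ convexHull ℝ S := by
  obtain ⟨-, hb⟩ := mem_E1_iff.1 hx
  refine mem_convexHull_of_four hS₁ hp hq hS₄ _ _ _ _ ?_ ?_ ?_ ?_ ?_ h <;>
    linarith [(hb a).1, (hb c).2]

/-- If `x ∈ E₁` and `x(2) ≤ x(3) ≤ x(4)` then `x ∈ co{v₁,v₂,v₃,v₄}`; moreover
`E₁` is the union of the six convex hulls `co{v_i : i ∈ A_k}` with
`A₁ = {1,2,3,4}`, `A₂ = {1,3,4,5}`, `A₃ = {1,4,6,7}`, `A₄ = {1,2,4,8}`,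
`A₅ = {1,4,5,6}`, `A₆ = {1,4,7,8}` (all 0-indexed below). -/
theorem stmt9 :
    (∀ x ∈ E1, x 1 ≤ x 2 → x 2 ≤ x 3 →
      x ∈ convexHull ℝ {v 0, v 1, v 2, v 3}) ∧
    E1 = convexHull ℝ {v 0, v 1, v 2, v 3} ∪ convexHull ℝ {v 0, v 2, v 3, v 4} ∪
      convexHull ℝ {v 0, v 3, v 5, v 6} ∪ convexHull ℝ {v 0, v 1, v 3, v 7} ∪
      convexHull ℝ {v 0, v 3, v 4, v 5} ∪ convexHull ℝ {v 0, v 3, v 6, v 7} := by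
  have first : ∀ x ∈ E1, x 1 ≤ x 2 → x 2 ≤ x 3 →
      x ∈ convexHull ℝ {v 0, v 1, v 2, v 3} := fun x hx h12 h23 =>
    mem_convexHull_of_sorted hx 1 2 3 (p := v 1) (q := v 2) (by simp) (by simp) (by simp)
      (by simp) h12 h23 (by ext k; fin_cases k <;> simp [v, (mem_E1_iff.1 hx).1] <;> ring)
  refine ⟨first, Set.Subset.antisymm (fun x hx => ?_) ?_⟩
  · have hx0 := (mem_E1_iff.1 hx).1
    simp only [Set.mem_union, or_assoc]
    rcases le_total (x 1) (x 2) with h12 | h21 <;> rcases le_total (x 2) (x 3) with h23 | h32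
    · exact .inl (first x hx h12 h23)
    · rcases le_total (x 1) (x 3) with h13 | h31
      · refine .inr <| .inr <| .inr <| .inl <|
          mem_convexHull_of_sorted hx 1 3 2 (p := v 1) (q := v 7) (by simp) (by simp) (by simp)
            (by simp) h13 h32 ?_
        ext k; fin_cases k <;> simp [v, hx0] <;> ring
      · refine .inr <| .inr <| .inr <| .inr <| .inr <|
          mem_convexHull_of_sorted hx 3 1 2 (p := v 6) (q := v 7) (by simp) (by simp) (by simp)
            (by simp) h31 h12 ?_
        ext k; fin_cases k <;> simp [v, hx0] <;> ring
    · rcases le_total (x 1) (x 3) with h13 | h31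
      · refine .inr <| .inl <|
          mem_convexHull_of_sorted hx 2 1 3 (p := v 4) (q := v 2) (by simp) (by simp) (by simp)
            (by simp) h21 h13 ?_
        ext k; fin_cases k <;> simp [v, hx0] <;> ring
      · refine .inr <| .inr <| .inr <| .inr <| .inl <|
          mem_convexHull_of_sorted hx 2 3 1 (p := v 4) (q := v 5) (by simp) (by simp) (by simp)
            (by simp) h23 h31 ?_
        ext k; fin_cases k <;> simp [v, hx0] <;> ring
    · refine .inr <| .inr <| .inl <|
        mem_convexHull_of_sorted hx 3 2 1 (p := v 6) (q := v 5) (by simp) (by simp) (by simp)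
          (by simp) h32 h21 ?_
      ext k; fin_cases k <;> simp [v, hx0] <;> ring
  · simp only [Set.union_subset_iff, convexHull_v_subset_E1, and_self]
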